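/- arXiv:math/0508479 — 3 statements merged into one kernel-verified Lean document; each statement's English description precedes it below -/
import Mathlib

section
/- (Clifford's theorem; the Mathlib-expressible instance of Proposition q10 that every normal quotient of a semisimple tannakian category is semisimple.) Let k be a field, G a group, N a normal subgroup of G, and V a finite-dimensional k-vector space equipped with a representation of G. If V is a semisimple module over the group algebra MonoidAlgebra k G, then V, regarded via the inclusion N → G as a module over MonoidAlgebra k N, is semisimple. -/
/-!
STATEMENT 3 (Clifford's theorem): Let `k` be a field, `G` a group, `N` a normal subgroup
of `G`, and `V` a finite-dimensional `k`-vector space with a representation `ρ` of `G`.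
If `V` is semisimple as a `MonoidAlgebra k G`-module, then `V`, regarded as a
`MonoidAlgebra k N`-module via the inclusion `N → G`, is semisimple.
-/

universe u

/-- Translation by `g : G` on the subrepresentations of the restriction of a representation of `G`
to a normal subgroup, sending `W` to its preimage under `ρ g`. -/
def Subrepresentation.comapNormal {k G V : Type*} [Semiring k] [Group G] [AddCommMonoid V]
    [Module k V] {ρ : Representation k G V} {N : Subgroup G} [hN : N.Normal] (g : G)
    (W : Subrepresentation (ρ.comp N.subtype)) : Subrepresentation (ρ.comp N.subtype) where
  toSubmodule := W.toSubmodule.comap (ρ g)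
  apply_mem_toSubmodule n v hv := by
    have h := W.apply_mem_toSubmodule ⟨g * n * g⁻¹, hN.conj_mem n n.2 g⟩ hv
    simpa [← Module.End.mul_apply, ← map_mul] using h

/-- Translation by `g : G` as an automorphism of the lattice of subrepresentations of the
restriction of a representation of `G` to a normal subgroup. -/
def Subrepresentation.comapNormalOrderIso {k G V : Type*} [Semiring k] [Group G]
    [AddCommMonoid V] [Module k V] (ρ : Representation k G V) (N : Subgroup G) [N.Normal] (g : G) :
    Subrepresentation (ρ.comp N.subtype) ≃o Subrepresentation (ρ.comp N.subtype) where
  toFun := comapNormal g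
  invFun := comapNormal g⁻¹
  left_inv W := by
    apply toSubmodule_injective
    ext v
    simp [comapNormal]
  right_inv W := by
    apply toSubmodule_injective
    ext v
    simp [comapNormal]
  map_rel_iff' {W W'} := by
    refine ⟨fun h v hv => ?_, fun h v hv => h hv⟩
    have hv' : ρ g⁻¹ v ∈ comapNormal g W := by
      change ρ g (ρ g⁻¹ v) ∈ W
      simpa using hv
    have h' : ρ g (ρ g⁻¹ v) ∈ W' := h hv'
    simpa using h'

/-- An automorphism of a complete lattice fixes the supremum of the atoms. -/
theorem OrderIso.map_sSup_atoms {α : Type*} [CompleteLattice α] (e : α ≃o α) :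
    e (sSup {a | IsAtom a}) = sSup {a | IsAtom a} := by
  rw [e.map_sSup_eq_sSup_symm_preimage]
  congr 1
  ext a
  simp

theorem clifford_restriction_semisimple
    (k G : Type u) [Field k] [Group G] (N : Subgroup G) [N.Normal]
    (V : Type u) [AddCommGroup V] [Module k V] [FiniteDimensional k V]
    (ρ : Representation k G V)
    (h : IsSemisimpleModule (MonoidAlgebra k G) ρ.asModule) :
    IsSemisimpleModule (MonoidAlgebra k ↥N)
      (Representation.asModule (ρ.comp N.subtype)) := by
  let τ : Representation k N V := ρ.comp N.subtype
  let e : Subrepresentation τ ≃o Submodule (MonoidAlgebra k N) τ.asModule :=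
    Subrepresentation.subrepresentationSubmoduleOrderIso
  have : IsArtinian k τ.asModule := isArtinian_of_linearEquiv τ.asModuleEquiv.symm
  have : IsArtinian (MonoidAlgebra k N) τ.asModule := isArtinian_of_tower k inferInstance
  have hcompl : ComplementedLattice (Subrepresentation ρ) :=
    ρ.isSemisimpleRepresentation_iff_isSemisimpleModule_asModule.mpr h
  let S : Submodule (MonoidAlgebra k N) τ.asModule := sSup {m | IsAtom m}
  let S' : Subrepresentation ρ :=
    { toSubmodule := (e.symm S).toSubmodule
      apply_mem_toSubmodule := fun g v hv => by
        have hg := OrderIso.map_sSup_atoms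
          (e.symm.trans ((Subrepresentation.comapNormalOrderIso ρ N g).trans e))
        have hv' : v ∈ S := hv
        exact hg.ge hv' }
  obtain ⟨C', hC'⟩ := exists_isCompl S'
  let C : Submodule (MonoidAlgebra k N) τ.asModule :=
    e ⟨C'.toSubmodule, fun n v hv => C'.apply_mem_toSubmodule n hv⟩
  have hdisj : Disjoint S C := by
    refine disjoint_iff_inf_le.mpr fun v hv => ?_
    exact hC'.disjoint.le_bot (show v ∈ S' ⊓ C' from hv)
  have hC : C = ⊥ := by
    refine (eq_bot_or_exists_atom_le C).resolve_right ?_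
    rintro ⟨a, ha, haC⟩
    exact ha.1 (le_bot_iff.mp (hdisj (le_sSup ha) haC))
  have hC'bot : C' = ⊥ := by
    refine le_bot_iff.mp fun v hv => ?_
    exact hC.le (show v ∈ C from hv)
  have hS' : S' = ⊤ := by
    rw [hC'bot] at hC'
    exact eq_top_of_isCompl_bot hC'
  have hS : S = ⊤ := by
    refine top_le_iff.mp fun v _ => ?_
    exact hS'.ge (show (v : V) ∈ (⊤ : Subrepresentation ρ) from Submodule.mem_top (R := k))
  exact { __ := complementedLattice_of_sSup_atoms_eq_top hS }
end

section
/- Let k be a field, G a group, N a normal subgroup of G, and (V, ρ) a k-linear representation of G. If W is a k-subspace of V that is stable under the action of N and is simple as a MonoidAlgebra k N-module, then for every g ∈ G the image ρ(g)(W) is again a k-subspace stable under the action of N and simple as a MonoidAlgebra k N-module. (This is the key translation step of Clifford theory, the expressible intermediate claim underlying Proposition q10 on semisimplicity of normal quotients.) -/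
/-!
STATEMENT 8: Let `k` be a field, `G` a group, `N` a normal subgroup of `G`, and
`(V, ρ)` a `k`-linear representation of `G`. If `W` is an `N`-stable `k`-subspace of
`V` that is simple as a `MonoidAlgebra k N`-module (i.e., nonzero with no `N`-stable
subspaces other than `0` and itself), then for every `g ∈ G` the image `ρ(g)(W)` is
again an `N`-stable subspace that is simple as a `MonoidAlgebra k N`-module.
-/

universe u

/-- The translate of an `N`-stable subspace by an element of `G` is `N`-stable, for `N` normal. -/
theorem Representation.map_stable_of_normal {k G V : Type*} [CommSemiring k] [Group G]
    [AddCommMonoid V] [Module k V] (ρ : Representation k G V) (N : Subgroup G) [hN : N.Normal]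
    {U : Submodule k V} (hU : ∀ n : N, ∀ v ∈ U, ρ (↑n : G) v ∈ U) (g : G) (n : N) :
    ∀ v ∈ U.map (ρ g), ρ (↑n : G) v ∈ U.map (ρ g) := by
  rintro _ ⟨w, hw, rfl⟩
  refine ⟨ρ (g⁻¹ * n * g) w, hU ⟨_, by simpa using hN.conj_mem n n.2 g⁻¹⟩ w hw, ?_⟩
  simp only [← Module.End.mul_apply, ← map_mul]
  congr 2
  group

theorem Representation.map_map_inv {k G V : Type*} [CommSemiring k] [Group G]
    [AddCommMonoid V] [Module k V] (ρ : Representation k G V) (g : G) (U : Submodule k V) :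
    (U.map (ρ g⁻¹)).map (ρ g) = U := by
  rw [← Submodule.map_comp, ← Module.End.mul_eq_comp, ← map_mul, mul_inv_cancel, map_one,
    Module.End.one_eq_id, Submodule.map_id]

theorem image_of_simple_N_stable_subspace_is_simple
    (k G : Type u) [Field k] [Group G] (N : Subgroup G) [N.Normal]
    (V : Type u) [AddCommGroup V] [Module k V] (ρ : Representation k G V)
    (W : Submodule k V)
    (hstab : ∀ n : N, ∀ v ∈ W, ρ (↑n : G) v ∈ W)
    (hne : W ≠ ⊥)
    (hsimple : ∀ U : Submodule k V, U ≤ W →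
        (∀ n : N, ∀ v ∈ U, ρ (↑n : G) v ∈ U) → U = ⊥ ∨ U = W)
    (g : G) :
    (∀ n : N, ∀ v ∈ W.map (ρ g), ρ (↑n : G) v ∈ W.map (ρ g)) ∧
    W.map (ρ g) ≠ ⊥ ∧
    (∀ U : Submodule k V, U ≤ W.map (ρ g) →
        (∀ n : N, ∀ v ∈ U, ρ (↑n : G) v ∈ U) → U = ⊥ ∨ U = W.map (ρ g)) := by
  have inv_map (U : Submodule k V) : (U.map (ρ g)).map (ρ g⁻¹) = U := by
    simpa using ρ.map_map_inv g⁻¹ U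
  refine ⟨ρ.map_stable_of_normal N hstab g, fun h => hne ?_, fun U hUW hU => ?_⟩
  · rw [← inv_map W, h, Submodule.map_bot]
  · have hle : U.map (ρ g⁻¹) ≤ W := (Submodule.map_mono hUW).trans (inv_map W).le
    rw [← ρ.map_map_inv g U]
    refine (hsimple _ hle (ρ.map_stable_of_normal N hU g⁻¹)).imp (fun h => ?_) (fun h => ?_)
    · rw [h, Submodule.map_bot]
    · rw [h]
end

section
/- Let k be a field, G a group, N a normal subgroup of G, and (V, ρ) a k-linear representation of G. The sum of all k-subspaces of V that are stable under the action of N and simple as MonoidAlgebra k N-modules (the N-socle of V) is stable under the action of all of G, and hence is a G-subrepresentation of V. (This is the G-stability of the socle, the expressible intermediate claim underlying Proposition q10 on semisimplicity of normal quotients.) -/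
/-!
STATEMENT 9: Let `k` be a field, `G` a group, `N` a normal subgroup of `G`, and
`(V, ρ)` a `k`-linear representation of `G`. The sum (`sSup`) of all `N`-stable
`k`-subspaces of `V` that are simple as `MonoidAlgebra k N`-modules (the `N`-socle
of `V`) is stable under the action of all of `G`, hence is a `G`-subrepresentation.
-/

universe u

namespace Representation

variable {k G V : Type*} [Field k] [Group G] [AddCommGroup V] [Module k V]

/-- A translate of a subspace stable under a normal subgroup is again stable. -/
theorem map_stable_of_normal_s9 (ρ : Representation k G V) {N : Subgroup G} [hN : N.Normal]
    {W : Submodule k V} (hW : ∀ n : N, ∀ x ∈ W, ρ (n : G) x ∈ W) (g : G) :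
    ∀ n : N, ∀ x ∈ W.map (ρ g), ρ (n : G) x ∈ W.map (ρ g) := by
  rintro n _ ⟨x, hx, rfl⟩
  refine ⟨ρ (g⁻¹ * n * g) x, hW ⟨_, hN.conj_mem' n n.2 g⟩ x hx, ?_⟩
  simp only [← Module.End.mul_apply, ← map_mul]
  congr 2
  group

theorem map_map_inv_s9 (ρ : Representation k G V) (g : G) (W : Submodule k V) :
    (W.map (ρ g⁻¹)).map (ρ g) = W := by
  rw [← Submodule.map_comp, ← Module.End.mul_eq_comp, ← map_mul, mul_inv_cancel, map_one,
    Module.End.one_eq_id, Submodule.map_id]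

theorem map_inv_map (ρ : Representation k G V) (g : G) (W : Submodule k V) :
    (W.map (ρ g)).map (ρ g⁻¹) = W := by
  simpa using ρ.map_map_inv_s9 g⁻¹ W

/-- A translate of a subspace simple under a normal subgroup is again simple. -/
theorem map_simple_of_normal (ρ : Representation k G V) {N : Subgroup G} [N.Normal]
    {W : Submodule k V} (hbot : W ≠ ⊥)
    (hW : ∀ U : Submodule k V, U ≤ W →
      (∀ n : N, ∀ x ∈ U, ρ (n : G) x ∈ U) → U = ⊥ ∨ U = W) (g : G) :
    W.map (ρ g) ≠ ⊥ ∧ ∀ U : Submodule k V, U ≤ W.map (ρ g) →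
      (∀ n : N, ∀ x ∈ U, ρ (n : G) x ∈ U) → U = ⊥ ∨ U = W.map (ρ g) := by
  refine ⟨fun h => hbot ?_, fun U hU hUN => ?_⟩
  · rw [← ρ.map_inv_map g W, h, Submodule.map_bot]
  · have hle : U.map (ρ g⁻¹) ≤ W := by
      simpa only [map_inv_map] using Submodule.map_mono (f := ρ g⁻¹) hU
    refine (hW _ hle (ρ.map_stable_of_normal_s9 hUN g⁻¹)).imp (fun h => ?_) (fun h => ?_)
    · rw [← ρ.map_map_inv_s9 g U, h, Submodule.map_bot]
    · rw [← h, map_map_inv_s9]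

end Representation

theorem N_socle_is_G_stable
    (k G : Type u) [Field k] [Group G] (N : Subgroup G) [N.Normal]
    (V : Type u) [AddCommGroup V] [Module k V] (ρ : Representation k G V) :
    ∀ g : G, ∀ v ∈ sSup {W : Submodule k V |
        (∀ n : N, ∀ x ∈ W, ρ (↑n : G) x ∈ W) ∧ W ≠ ⊥ ∧
        ∀ U : Submodule k V, U ≤ W →
          (∀ n : N, ∀ x ∈ U, ρ (↑n : G) x ∈ U) → U = ⊥ ∨ U = W},
      ρ g v ∈ sSup {W : Submodule k V |
        (∀ n : N, ∀ x ∈ W, ρ (↑n : G) x ∈ W) ∧ W ≠ ⊥ ∧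
        ∀ U : Submodule k V, U ≤ W →
          (∀ n : N, ∀ x ∈ U, ρ (↑n : G) x ∈ U) → U = ⊥ ∨ U = W} := by
  intro g v hv
  refine (sSup_le fun W hW => ?_ : sSup _ ≤ Submodule.comap (ρ g) (sSup _)) hv
  exact Submodule.map_le_iff_le_comap.mp <| le_sSup
    ⟨ρ.map_stable_of_normal_s9 hW.1 g, ρ.map_simple_of_normal hW.2.1 hW.2.2 g⟩
end
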